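/- Let X be a normal subgroup of a finite group Y with Y/X abelian, and let χ ∈ Irr(Y) be an irreducible (complex) character whose restriction to X is multiplicity free. Let ϑ ∈ Irr(X) be an irreducible constituent of χ|_X. Then the inertia group I_Y(ϑ) of ϑ in Y equals the intersection of the kernels of all linear characters λ of Y/X (inflated to Y) satisfying λχ = χ. -/

import Mathlib

open scoped Classical BigOperators

/-- The inner product of two class functions on a finite group. -/
noncomputable def charInner {G : Type} [Group G] (φ ψ : G → ℂ) : ℂ :=
  (Nat.card G : ℂ)⁻¹ * ∑ᶠ g : G, φ g * ψ g⁻¹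

/-- `χ : G → ℂ` is an irreducible (complex) character of `G`. -/
def IsIrredChar (G : Type) [Group G] (χ : G → ℂ) : Prop :=
  ∃ V : FDRep ℂ G, CategoryTheory.Simple V ∧ χ = V.character

open Representation CategoryTheory

/-- The representation underlying a simple object of `FDRep` is irreducible. -/
lemma FDRep.isIrreducible_of_simple {k : Type} [Field k] {G : Type} [Group G] (V : FDRep k G)
    [Simple V] : Representation.IsIrreducible V.ρ where
  exists_pair_ne := by
    refine ⟨⊥, ⊤, fun h => id_nonzero V ?_⟩
    ext v
    have hv : v ∈ (⊤ : Subrepresentation V.ρ) := trivial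
    rw [← h] at hv
    exact hv
  eq_bot_or_eq_top S := by
    let U : FDRep k G := FDRep.of S.toRepresentation
    let f : U ⟶ V :=
      ⟨FGModuleCat.ofHom S.toSubmodule.subtype, fun g => by ext; rfl⟩
    have hf : Function.Injective f.hom := Subtype.val_injective
    have : Mono f := by
      refine (forget (FDRep k G)).mono_of_mono_map ?_
      exact (mono_iff_injective _).2 hf
    by_cases h0 : f = 0
    · left
      refine le_bot_iff.1 fun v hv => ?_
      have := congrArg (fun t : U ⟶ V => t.hom (⟨v, hv⟩ : S.toSubmodule)) h0
      exact this
    · right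
      have := isIso_of_mono_of_nonzero h0
      refine top_le_iff.1 fun v _ => ?_
      have hv : f.hom ((inv f).hom v) = v :=
        congrArg (fun t : V ⟶ V => t.hom v) (IsIso.inv_hom_id f)
      rw [← hv]
      exact ((inv f).hom v : S.toSubmodule).2

section

variable {G V W : Type} [Group G] [AddCommGroup V] [Module ℂ V] [AddCommGroup W] [Module ℂ W]

/-- The product of a representation with a linear character. -/
def Representation.linearTwist (lam : G →* ℂ) (ρ : Representation ℂ G V) :
    Representation ℂ G V where
  toFun g := lam g • ρ g
  map_one' := by simp
  map_mul' a b := by rw [map_mul, map_mul, smul_mul_smul_comm]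

lemma Representation.linearTwist_apply (lam : G →* ℂ) (ρ : Representation ℂ G V) (g : G) :
    ρ.linearTwist lam g = lam g • ρ g := rfl

lemma Representation.character_linearTwist (lam : G →* ℂ) (ρ : Representation ℂ G V) (g : G) :
    (ρ.linearTwist lam).character g = lam g * ρ.character g := by
  simp [Representation.character, Representation.linearTwist_apply]

/-- The linear characters of an abelian quotient separate its elements, in the form of the second
orthogonality relation. -/
lemma exists_linearCharacters_sum_eq [Finite G] (X : Subgroup G) [X.Normal]
    (hab : ∀ a b : G ⧸ X, a * b = b * a) :
    ∃ (ι : Type) (_ : Fintype ι) (f : ι → G →* ℂ), (∀ i, ∀ x ∈ X, f i x = 1) ∧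
      ∀ g, ∑ i, f i g = if g ∈ X then (Nat.card (G ⧸ X) : ℂ) else 0 := by
  let : CommGroup (G ⧸ X) := { QuotientGroup.Quotient.group X with mul_comm := hab }
  let : Fintype (G ⧸ X) := Fintype.ofFinite _
  let f (ψ : AddChar (Additive (G ⧸ X)) ℂ) : G →* ℂ :=
    { toFun := fun g => ψ (Additive.ofMul (g : G ⧸ X))
      map_one' := by simp
      map_mul' := fun a b => by
        rw [QuotientGroup.mk_mul, ofMul_mul, AddChar.map_add_eq_mul] }
  refine ⟨AddChar (Additive (G ⧸ X)) ℂ, inferInstance, f, fun ψ x hx => ?_, fun g => ?_⟩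
  · change ψ (Additive.ofMul (x : G ⧸ X)) = 1
    rw [(QuotientGroup.eq_one_iff x).2 hx, ofMul_one, AddChar.map_zero_eq_one]
  · change ∑ ψ : AddChar (Additive (G ⧸ X)) ℂ, ψ (Additive.ofMul (g : G ⧸ X)) = _
    rw [AddChar.sum_apply_eq_ite]
    simp [ofMul_eq_zero, QuotientGroup.eq_one_iff, Nat.card_eq_fintype_card]

/-- An operator commuting with a normal subgroup `X` with abelian quotient commutes with every
element lying in the kernels of those linear characters of `G ⧸ X` which occur in the conjugation
action on operators. -/
lemma conj_eq_self_of_linearCharacters [Finite G] (X : Subgroup G) [X.Normal]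
    (hab : ∀ a b : G ⧸ X, a * b = b * a) (ρ : Representation ℂ G V) (T : V →ₗ[ℂ] V)
    (hT : ∀ x ∈ X, ρ x * T * ρ x⁻¹ = T) (y : G)
    (hy : ∀ lam : G →* ℂ, (∀ x ∈ X, lam x = 1) →
      (∃ S : V →ₗ[ℂ] V, S ≠ 0 ∧ ∀ g, S * ρ g = lam g • (ρ g * S)) → lam y = 1) :
    ρ y * T * ρ y⁻¹ = T := by
  cases nonempty_fintype G
  obtain ⟨ι, _, f, hfX, hf⟩ := exists_linearCharacters_sum_eq X hab
  let P (i : ι) : V →ₗ[ℂ] V := ∑ g, f i g • (ρ g * T * ρ g⁻¹)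
  have hP (i : ι) (h : G) : ρ h * P i * ρ h⁻¹ = f i h⁻¹ • P i := by
    simp only [P, Finset.mul_sum, Finset.sum_mul, Finset.smul_sum]
    refine Fintype.sum_equiv (Equiv.mulLeft h) _ _ fun g => ?_
    simp only [Equiv.coe_mulLeft, mul_inv_rev, map_mul, smul_smul]
    rw [← mul_assoc, ← map_mul, inv_mul_cancel, map_one, one_mul]
    simp only [mul_smul_comm, smul_mul_assoc, mul_assoc]
  have hPy (i : ι) : ρ y * P i * ρ y⁻¹ = P i := by
    by_cases h0 : P i = 0
    · simp [h0]
    · have h1 : f i y = 1 := hy (f i) (hfX i) ⟨P i, h0, fun g => by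
        have h2 := congrArg (· * ρ g) (hP i g)
        simp only [mul_assoc, ← map_mul, inv_mul_cancel, map_one, mul_one] at h2
        rw [h2, smul_mul_assoc, smul_smul, ← map_mul, mul_inv_cancel, map_one, one_smul]⟩
      have h3 : f i y * f i y⁻¹ = 1 := by rw [← map_mul, mul_inv_cancel, map_one]
      rw [h1, one_mul] at h3
      rw [hP, h3, one_smul]
  let c : ℂ := ∑ g : G, if g ∈ X then (Nat.card (G ⧸ X) : ℂ) else 0
  have hc : c ≠ 0 := by
    simp only [c, ← Finset.sum_filter, Finset.sum_const, nsmul_eq_mul]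
    refine mul_ne_zero ?_ (Nat.cast_ne_zero.2 Nat.card_pos.ne')
    refine Nat.cast_ne_zero.2 (Finset.card_ne_zero_of_mem (a := 1) ?_)
    simp [X.one_mem]
  have hsum : ∑ i, P i = c • T := by
    simp only [P, c]
    rw [Finset.sum_comm, Finset.sum_smul]
    refine Finset.sum_congr rfl fun g _ => ?_
    rw [← Finset.sum_smul, hf]
    split_ifs with hg
    · rw [hT g hg]
    · simp
  have key : ρ y * (c • T) * ρ y⁻¹ = c • T := by
    rw [← hsum, Finset.mul_sum, Finset.sum_mul]
    exact Finset.sum_congr rfl fun i _ => hPy i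
  rw [mul_smul_comm, smul_mul_assoc] at key
  exact smul_right_injective _ hc key

variable [FiniteDimensional ℂ V] [FiniteDimensional ℂ W]

lemma charInner_character [Finite G] (ρ : Representation ℂ G V) (σ : Representation ℂ G W) :
    charInner σ.character ρ.character = Module.finrank ℂ (IntertwiningMap ρ σ) := by
  cases nonempty_fintype G
  have : Invertible (Nat.card G : ℂ) := invertibleOfNonzero (NeZero.ne _)
  rw [← card_inv_mul_sum_char_mul_char_eq_finrank, charInner, finsum_eq_sum_of_fintype]

lemma exists_intertwiningMap_ne_zero [Finite G] (ρ : Representation ℂ G V)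
    (σ : Representation ℂ G W) (h : charInner σ.character ρ.character ≠ 0) :
    ∃ f : IntertwiningMap ρ σ, f ≠ 0 := by
  rw [charInner_character] at h
  by_contra! hf
  have : Subsingleton (IntertwiningMap ρ σ) := ⟨fun a b => by rw [hf a, hf b]⟩
  exact h (by simp [Module.finrank_zero_of_subsingleton])

lemma charInner_self [Finite G] (ρ : Representation ℂ G V) [IsIrreducible ρ] :
    charInner ρ.character ρ.character = 1 := by
  rw [charInner_character]
  simp

lemma character_eq_of_ne_zero {ρ σ : Representation ℂ G V} [IsIrreducible ρ]
    (f : IntertwiningMap ρ σ) (hf : f ≠ 0) : ρ.character = σ.character := by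
  have hinj : Function.Injective f.toLinearMap :=
    (IsIrreducible.injective_or_eq_zero f).resolve_right hf
  exact char_iso (Representation.Equiv.mk (LinearEquiv.ofInjectiveEndo f.toLinearMap hinj)
    fun g => f.isIntertwining' g)

variable [Finite G] {X : Subgroup G} [hN : X.Normal] (ρ : Representation ℂ G V)
  [IsIrreducible ρ] (σ : Representation ℂ X W) [IsIrreducible σ]

lemma linearCharacter_eq_one_of_character_conj_eq
    (h1 : charInner (Representation.character (MonoidHom.comp ρ X.subtype)) σ.character = 1) (y : G)
    (hy : ∀ x, σ.character (MulAut.conjNormal y x) = σ.character x)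
    (lam : G →* ℂ) (hX : ∀ x ∈ X, lam x = 1)
    (hlam : ∀ g, lam g * ρ.character g = ρ.character g) : lam y = 1 := by
  obtain ⟨T, hT⟩ : ∃ T : IntertwiningMap ρ (ρ.linearTwist lam), T ≠ 0 := by
    refine exists_intertwiningMap_ne_zero _ _ ?_
    rw [show (ρ.linearTwist lam).character = ρ.character from
      funext fun g => (character_linearTwist lam ρ g).trans (hlam g), charInner_self]
    exact one_ne_zero
  have hTinj : Function.Injective T := (IsIrreducible.injective_or_eq_zero T).resolve_right hT
  have hTg (g : G) (v : V) : T (ρ g v) = lam g • ρ g (T v) := IntertwiningMap.isIntertwining _ _ T g v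
  let σ' : Representation ℂ X W := σ.comp (MulAut.conjNormal y⁻¹).toMonoidHom
  obtain ⟨S, hS⟩ : ∃ S : IntertwiningMap σ σ', S ≠ 0 := by
    refine exists_intertwiningMap_ne_zero _ _ ?_
    have : σ'.character = σ.character := funext fun x => by
      change σ.character (MulAut.conjNormal y⁻¹ x) = _
      rw [← hy, ← MulAut.mul_apply, ← map_mul]
      simp
    rw [this, charInner_self]
    exact one_ne_zero
  obtain ⟨i, hi⟩ := exists_intertwiningMap_ne_zero σ (MonoidHom.comp ρ X.subtype)
    (by rw [h1]; exact one_ne_zero)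
  have hdim : Module.finrank ℂ (IntertwiningMap σ (MonoidHom.comp ρ X.subtype)) = 1 := by
    rw [charInner_character] at h1
    exact_mod_cast h1
  have hiinj : Function.Injective i := (IsIrreducible.injective_or_eq_zero i).resolve_right hi
  have hix (x : X) (w : W) : i (σ x w) = ρ x (i w) := IntertwiningMap.isIntertwining _ _ i x w
  have hSx (x : X) (w : W) : S (σ x w) = σ (MulAut.conjNormal y⁻¹ x) (S w) := IntertwiningMap.isIntertwining _ _ S x w
  let Ti : IntertwiningMap σ (MonoidHom.comp ρ X.subtype) :=
    ⟨T.toLinearMap ∘ₗ i.toLinearMap, fun x => by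
      ext w
      change T (i (σ x w)) = ρ x (T (i w))
      rw [hix, hTg, hX x x.2, one_smul]⟩
  let j : IntertwiningMap σ (MonoidHom.comp ρ X.subtype) :=
    ⟨ρ y ∘ₗ i.toLinearMap ∘ₗ S.toLinearMap, fun x => by
      ext w
      change ρ y (i (S (σ x w))) = ρ x (ρ y (i (S w)))
      rw [hSx, hix, ← Module.End.mul_apply, ← Module.End.mul_apply, ← map_mul, ← map_mul]
      simp [mul_assoc]⟩
  obtain ⟨c, hc⟩ := (finrank_eq_one_iff_of_nonzero' i hi).1 hdim Ti
  obtain ⟨d, hd⟩ := (finrank_eq_one_iff_of_nonzero' i hi).1 hdim j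
  have hc' (w : W) : T (i w) = c • i w := (DFunLike.congr_fun hc w).symm
  have hd' (w : W) : ρ y (i (S w)) = d • i w := (DFunLike.congr_fun hd w).symm
  obtain ⟨w, hw⟩ : ∃ w, S w ≠ 0 := by
    by_contra! h
    exact hS (by ext w; exact h w)
  have hiw : i (S w) ≠ 0 := fun h => hw (hiinj (h.trans (map_zero i).symm))
  have hyw : ρ y (i (S w)) ≠ 0 := fun h => hiw (by
    have := congrArg (ρ y⁻¹) h
    rwa [← Module.End.mul_apply, ← map_mul, inv_mul_cancel, map_one, map_zero] at this)
  have hc0 : c ≠ 0 := fun h => by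
    have := hc' (S w)
    rw [h, zero_smul, ← map_zero T] at this
    exact hiw (hTinj this)
  have e1 : T (ρ y (i (S w))) = c • ρ y (i (S w)) := by
    rw [hd', map_smul, hc', smul_comm]
  have e2 : T (ρ y (i (S w))) = (lam y * c) • ρ y (i (S w)) := by
    rw [hTg, hc', map_smul, smul_smul]
  have e3 : c = lam y * c := smul_left_injective ℂ hyw (e1.symm.trans e2)
  exact (mul_eq_right₀ hc0).1 e3.symm

lemma character_conj_eq_of_linearCharacters (hab : ∀ a b : G ⧸ X, a * b = b * a)
    (hc : charInner (Representation.character (MonoidHom.comp ρ X.subtype)) σ.character ≠ 0) (y : G)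
    (hy : ∀ lam : G →* ℂ, (∀ x ∈ X, lam x = 1) →
      (∀ g, lam g * ρ.character g = ρ.character g) → lam y = 1) (x : X) :
    σ.character (MulAut.conjNormal y x) = σ.character x := by
  cases nonempty_fintype G
  obtain ⟨i, hi⟩ := exists_intertwiningMap_ne_zero _ _ hc
  have hiinj : Function.Injective i := (IsIrreducible.injective_or_eq_zero i).resolve_right hi
  have hix (x : X) (w : W) : i (σ x w) = ρ x (i w) := IntertwiningMap.isIntertwining _ _ i x w
  let T : V →ₗ[ℂ] V := ∑ x : X, σ.character x⁻¹ • ρ x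
  have hconj (g : G) :
      ρ g * T * ρ g⁻¹ = ∑ x : X, σ.character x⁻¹ • ρ (MulAut.conjNormal g x : X) := by
    simp only [T, Finset.mul_sum, Finset.sum_mul]
    refine Finset.sum_congr rfl fun x _ => ?_
    rw [mul_smul_comm, smul_mul_assoc, ← map_mul, ← map_mul, MulAut.conjNormal_apply]
  have hTX (g : G) (hg : g ∈ X) : ρ g * T * ρ g⁻¹ = T := by
    rw [hconj]
    refine Fintype.sum_equiv (MulAut.conjNormal g).toEquiv _ _ fun x => ?_
    have : σ.character (MulAut.conjNormal g x)⁻¹ = σ.character x⁻¹ := by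
      rw [← map_inv, ← char_conj σ x⁻¹ ⟨g, hg⟩]
      congr 1
    change _ = σ.character (MulAut.conjNormal g x)⁻¹ • _
    rw [this]
    rfl
  have hTy : ρ y * T * ρ y⁻¹ = T := by
    refine conj_eq_self_of_linearCharacters X hab ρ T hTX y fun lam hX ⟨S, hS0, hS⟩ => hy lam hX ?_
    let f : IntertwiningMap ρ (ρ.linearTwist lam) := ⟨S, hS⟩
    have hf : f ≠ 0 := fun h => hS0 (congrArg IntertwiningMap.toLinearMap h)
    exact fun g => (character_linearTwist lam ρ g).symm.trans
      (congrFun (character_eq_of_ne_zero f hf) g).symm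
  let σ' : Representation ℂ X W := σ.comp (MulAut.conjNormal y).toMonoidHom
  have hW : ∑ x : X, σ.character x⁻¹ • σ' x = ∑ x : X, σ.character x⁻¹ • σ x := by
    ext w
    apply hiinj
    have := congrArg (fun t : V →ₗ[ℂ] V => t (i w)) ((hconj y).symm.trans hTy)
    simp only [T, LinearMap.sum_apply, LinearMap.smul_apply, ← hix] at this
    simp only [LinearMap.sum_apply, LinearMap.smul_apply, map_sum, map_smul]
    exact this
  have hinner : charInner σ'.character σ.character = 1 := by
    rw [← charInner_self σ, charInner, charInner, finsum_eq_sum_of_fintype,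
      finsum_eq_sum_of_fintype]
    have := congrArg (LinearMap.trace ℂ W) hW
    simp only [map_sum, map_smul, smul_eq_mul] at this
    simp only [mul_comm _ (σ.character _⁻¹)]
    exact congrArg _ this
  obtain ⟨f, hf⟩ := exists_intertwiningMap_ne_zero σ σ' (by rw [hinner]; exact one_ne_zero)
  exact (congrFun (character_eq_of_ne_zero f hf) x).symm

end

/-- If `Y/X` is abelian and `χ ∈ Irr(Y)` restricts multiplicity-free to `X`, then for any
irreducible constituent `ϑ` of `χ|_X`, the inertia group of `ϑ` in `Y` is the intersection
of the kernels of the linear characters `λ` of `Y/X` with `λχ = χ`. -/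
theorem stmt_2 {Y : Type} [Group Y] [Fintype Y] (X : Subgroup Y) [hN : X.Normal]
    (hab : ∀ a b : Y ⧸ X, a * b = b * a)
    (χ : Y → ℂ) (hχ : IsIrredChar Y χ)
    (hmf : ∀ ρ : ↥X → ℂ, IsIrredChar ↥X ρ →
      charInner (fun x : ↥X => χ ↑x) ρ = 0 ∨ charInner (fun x : ↥X => χ ↑x) ρ = 1)
    (ϑ : ↥X → ℂ) (hϑ : IsIrredChar ↥X ϑ)
    (hc : charInner (fun x : ↥X => χ ↑x) ϑ ≠ 0) :
    ∀ y : Y, (∀ x : ↥X, ϑ ⟨y * ↑x * y⁻¹, hN.conj_mem ↑x x.2 y⟩ = ϑ x) ↔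
      (∀ lam : Y →* ℂ, (∀ x ∈ X, lam x = 1) → (∀ g, lam g * χ g = χ g) → lam y = 1) := by
  obtain ⟨V, hV, rfl⟩ := hχ
  obtain ⟨W, hW, rfl⟩ := hϑ
  have := FDRep.isIrreducible_of_simple V
  have := FDRep.isIrreducible_of_simple W
  have h1 := (hmf W.character ⟨W, hW, rfl⟩).resolve_left hc
  refine fun y => ⟨fun hy => ?_, fun hy x => ?_⟩
  · exact linearCharacter_eq_one_of_character_conj_eq V.ρ W.ρ h1 y hy
  · exact character_conj_eq_of_linearCharacters V.ρ W.ρ hab hc y hy x
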